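/- arXiv:1905.06713 — 2 statements merged into one kernel-verified Lean document; each statement's English description precedes it below -/
import Mathlib

section
/- Let X be a countable set, F = (F_x)_{x∈X} a family of finite-dimensional complex normed vector spaces, and A : Γ(X;F) → Γ(X;F) a continuous linear operator on Γ(X;F) = ∏_x F_x (product topology). For finite K ⊆ X set U_K = {f ∈ Γ(X;F) : ∑_{x∈K} ‖f(x)‖_x ≤ 1}. Assume the dual operator A' : Γ_c(X;F') → Γ_c(X;F') is injective (i.e., if φ ∈ Γ_c(X;F') satisfies ∑_x φ_x(Af(x)) = 0 for all f, then φ = 0). Then for every nonempty finite K ⊆ X there exist ε > 0 and a nonempty finite K' ⊆ X such that the closure of A(U_K) in Γ(X;F) contains ε·U_{K'}. -/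
noncomputable def extFin {X : Type*} (F : X → Type*) [∀ x, NormedAddCommGroup (F x)]
    [∀ x, NormedSpace ℂ (F x)] (S : Finset X) : (∀ x : S, F x) →L[ℂ] (∀ x, F x) :=
  open Classical in
  ContinuousLinearMap.pi (fun x => if h : x ∈ S then
    (ContinuousLinearMap.proj (R := ℂ) (φ := fun y : S => F y) ⟨x, h⟩) else 0)

lemma extFin_mem {X : Type*} (F : X → Type*) [∀ x, NormedAddCommGroup (F x)]
    [∀ x, NormedSpace ℂ (F x)] (S : Finset X) (p : ∀ x : S, F x) (x : X) (h : x ∈ S) :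
    extFin F S p x = p ⟨x, h⟩ := by
  simp [extFin, h]

lemma extFin_not_mem {X : Type*} (F : X → Type*) [∀ x, NormedAddCommGroup (F x)]
    [∀ x, NormedSpace ℂ (F x)] (S : Finset X) (p : ∀ x : S, F x) (x : X) (h : x ∉ S) :
    extFin F S p x = 0 := by
  simp [extFin, h]

/-- A functional vanishing on `{f | f = 0 on S}` factors through the restriction to `S`. -/
lemma factor_ext {X : Type*} (F : X → Type*) [∀ x, NormedAddCommGroup (F x)]
    [∀ x, NormedSpace ℂ (F x)] (S : Finset X) (ψ : (∀ x, F x) →ₗ[ℂ] ℂ)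
    (h : ∀ f : ∀ x, F x, (∀ x ∈ S, f x = 0) → ψ f = 0) (f : ∀ x, F x) :
    ψ (extFin F S (fun x => f x)) = ψ f := by
  rw [← sub_eq_zero, ← map_sub]
  apply h
  intro x hx
  simp [extFin_mem F S _ x hx]

lemma exists_support {X : Type*} (F : X → Type*) [∀ x, NormedAddCommGroup (F x)]
    [∀ x, NormedSpace ℂ (F x)] (ψ : (∀ x, F x) →L[ℂ] ℂ) :
    ∃ S : Finset X, ∀ f : ∀ x, F x, (∀ x ∈ S, f x = 0) → ψ f = 0 := by
  have h : ψ ⁻¹' (Metric.ball 0 1) ∈ nhds (0 : ∀ x, F x) := by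
    apply ψ.continuous.continuousAt.preimage_mem_nhds
    rw [map_zero]
    exact Metric.ball_mem_nhds _ one_pos
  rw [nhds_pi, Filter.mem_pi] at h
  obtain ⟨I, hI, t, ht, hsub⟩ := h
  refine ⟨hI.toFinset, fun f hf => ?_⟩
  by_contra hne
  have : (ψ f)⁻¹ • f ∈ ψ ⁻¹' (Metric.ball 0 1) := by
    apply hsub
    intro x hx
    have : f x = 0 := hf x (by simpa using hx)
    simpa [this] using mem_of_mem_nhds (ht x)
  simp [hne] at this

/-- Injectivity of the dual operator, stated for continuous functionals on the product. -/
lemma dual_inj {X : Type*}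
    (F : X → Type*) [∀ x, NormedAddCommGroup (F x)] [∀ x, NormedSpace ℂ (F x)]
    (A : (∀ x, F x) →L[ℂ] (∀ x, F x))
    (hinj : ∀ φ : ∀ x, F x →L[ℂ] ℂ, {x | φ x ≠ 0}.Finite →
      (∀ f : ∀ x, F x, ∑ᶠ x, φ x (A f x) = 0) → ∀ x, φ x = 0)
    (ψ : (∀ x, F x) →L[ℂ] ℂ) (hψ : ∀ f, ψ (A f) = 0) : ψ = 0 := by
  classical
  obtain ⟨S, hS⟩ := exists_support F ψ
  let φ : ∀ x, F x →L[ℂ] ℂ := fun x => ψ.comp (ContinuousLinearMap.single ℂ F x)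
  have hφ0 : ∀ x, x ∉ S → φ x = 0 := by
    intro x hx
    ext v
    apply hS
    intro y hy
    have : y ≠ x := fun h => hx (h ▸ hy)
    simp [this]
  have key : ∀ g, ∑ᶠ x, φ x (g x) = ψ g := by
    intro g
    rw [finsum_eq_sum_of_support_subset (s := S)]
    · simp only [φ, ContinuousLinearMap.comp_apply]
      rw [← map_sum, ← sub_eq_zero, ← map_sub]
      apply hS
      intro x hx
      simp [Finset.sum_apply, Finset.sum_pi_single, hx]
    · intro x hx
      by_contra hxS
      exact hx (by simp [hφ0 x (by simpa using hxS)])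
  have hz := hinj φ (S.finite_toSet.subset fun x hx => by
    by_contra hxS
    exact hx (hφ0 x (by simpa using hxS))) (fun f => by rw [key, hψ])
  ext g
  rw [← key g]
  simp [hz]

/-- The functionals in the polar of `A(U_K)` are uniformly controlled on one finite set. -/
lemma polar_bound {X : Type*}
    (F : X → Type*) [∀ x, NormedAddCommGroup (F x)] [∀ x, NormedSpace ℂ (F x)]
    [∀ x, FiniteDimensional ℂ (F x)]
    (A : (∀ x, F x) →L[ℂ] (∀ x, F x))
    (hA : ∀ ψ : (∀ x, F x) →L[ℂ] ℂ, (∀ f, ψ (A f) = 0) → ψ = 0) (K : Finset X) :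
    ∃ C : ℝ, 0 < C ∧ ∃ K' : Finset X, K ⊆ K' ∧ ∀ (ψ : (∀ x, F x) →L[ℂ] ℂ) (u : ℝ),
      (∀ f, ‖ψ (A f)‖ ≤ u * ∑ x ∈ K, ‖f x‖) → 0 ≤ u → ∀ g, ‖ψ g‖ ≤ C * u * ∑ x ∈ K', ‖g x‖ := by
  classical
  let W : Submodule ℂ ((∀ x, F x) →L[ℂ] ℂ) :=
    { carrier := {ψ | ∀ f : ∀ x, F x, (∀ x ∈ K, f x = 0) → ψ (A f) = 0}
      add_mem' := by
        intro a b ha hb f hf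
        simp [ha f hf, hb f hf]
      zero_mem' := by
        intro f hf
        simp
      smul_mem' := by
        intro c a ha f hf
        simp [ha f hf] }
  let T : W →ₗ[ℂ] ((∀ x : K, F x) →L[ℂ] ℂ) :=
    { toFun := fun ψ => (ψ.1.comp A).comp (extFin F K)
      map_add' := by
        intro a b
        ext p
        simp
      map_smul' := by
        intro c a
        ext p
        simp }
  have hT : LinearMap.ker T = ⊥ := by
    rw [LinearMap.ker_eq_bot']
    intro ψ h
    apply Subtype.ext
    apply hA
    intro f
    have h1 := factor_ext F K (ψ.1.comp A : (∀ x, F x) →L[ℂ] ℂ).toLinearMap ψ.2 f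
    have h2 := DFunLike.congr_fun h (fun x : K => f x)
    exact h1.symm.trans h2
  have hTi : Function.Injective T := by
    rw [injective_iff_map_eq_zero]
    exact LinearMap.ker_eq_bot'.1 hT
  have hWfin : FiniteDimensional ℂ W :=
    FiniteDimensional.of_injective T hTi
  obtain ⟨s, hs⟩ := (Submodule.fg_iff_finiteDimensional W).2 hWfin
  choose S hS using exists_support F
  let K' := K ∪ s.biUnion S
  have hK' : ∀ ψ ∈ W, ∀ f : ∀ x, F x, (∀ x ∈ K', f x = 0) → ψ f = 0 := by
    intro ψ hψ f hf
    rw [← hs] at hψ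
    induction hψ using Submodule.span_induction with
    | mem ψ h =>
      exact hS ψ f fun x hx => hf x (Finset.mem_union_right _ (Finset.mem_biUnion.2 ⟨ψ, h, hx⟩))
    | zero => simp
    | add a b _ _ ha hb => simp [ha, hb]
    | smul c a _ ha => simp [ha]
  have hLex : ∃ L : ((∀ x : K, F x) →L[ℂ] ℂ) →ₗ[ℂ] W, L ∘ₗ T = LinearMap.id :=
    LinearMap.exists_leftInverse_of_injective (K := ℂ) (V := W)
      (V' := ((∀ x : K, F x) →L[ℂ] ℂ)) T hT
  obtain ⟨L, hL⟩ := hLex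
  let M : ((∀ x : K, F x) →L[ℂ] ℂ) →ₗ[ℂ] ((∀ x : K', F x) →L[ℂ] ℂ) :=
    { toFun := fun ξ => (L ξ).1.comp (extFin F K')
      map_add' := by
        intro a b
        ext p
        simp
      map_smul' := by
        intro c a
        ext p
        simp }
  let M' := LinearMap.toContinuousLinearMap M
  refine ⟨(‖M'‖ + 1) * (K.card + 1), by positivity, K', Finset.subset_union_left, ?_⟩
  intro ψ u hψ hu g
  have hW : ψ ∈ W := by
    intro f hf
    have := hψ f
    rw [Finset.sum_eq_zero (fun x hx => by simp [hf x hx]), mul_zero] at this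
    simpa using this
  have h1 : ψ (extFin F K' (fun x => g x)) = ψ g :=
    factor_ext F K' ψ.toLinearMap (hK' ψ hW) g
  have h2 : M' (T ⟨ψ, hW⟩) (fun x => g x) = ψ g := by
    rw [← h1]
    have := LinearMap.congr_fun hL ⟨ψ, hW⟩
    simp only [LinearMap.comp_apply, LinearMap.id_apply] at this
    change (L (T ⟨ψ, hW⟩)).1 _ = _
    rw [this]
    rfl
  have h3 : ‖T ⟨ψ, hW⟩‖ ≤ u * (K.card + 1) := by
    refine ContinuousLinearMap.opNorm_le_bound _ (by positivity) fun p => ?_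
    refine (hψ (extFin F K p)).trans ?_
    rw [mul_assoc]
    gcongr
    calc ∑ x ∈ K, ‖extFin F K p x‖ ≤ ∑ x ∈ K, ‖p‖ := by
          refine Finset.sum_le_sum fun x hx => ?_
          rw [extFin_mem F K p x hx]
          exact norm_le_pi_norm p ⟨x, hx⟩
      _ = K.card * ‖p‖ := by simp
      _ ≤ _ := by gcongr; linarith
  have h4 : ‖(fun x : K' => g x)‖ ≤ ∑ x ∈ K', ‖g x‖ := by
    rw [pi_norm_le_iff_of_nonneg (by positivity)]
    intro x
    exact Finset.single_le_sum (f := fun x => ‖g x‖) (fun _ _ => norm_nonneg _) x.2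
  rw [← h2]
  calc _ ≤ ‖M'‖ * ‖T ⟨ψ, hW⟩‖ * ‖(fun x : K' => g x)‖ :=
        (ContinuousLinearMap.le_opNorm _ _).trans (by gcongr; exact M'.le_opNorm _)
    _ ≤ (‖M'‖ + 1) * (u * (K.card + 1)) * ∑ x ∈ K', ‖g x‖ := by
        gcongr
        linarith
    _ = _ := by ring


/-- **Main lemma (with closure).**
Let `X` be a countable set, `F = (F x)_{x ∈ X}` a family of finite-dimensional complex normed
vector spaces and `A` a continuous linear operator on `Γ(X;F) = ∀ x, F x` (product topology).
For finite `K ⊆ X` let `U_K = {f | ∑_{x ∈ K} ‖f x‖ ≤ 1}`.  If the dual operator is injective,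
i.e. every finitely supported family `φ` of functionals with `∑ x, φ x (A f x) = 0` for all `f`
vanishes, then for every nonempty finite `K ⊆ X` there are `ε > 0` and a nonempty finite
`K' ⊆ X` with `ε·U_{K'} ⊆ closure (A(U_K))`. -/
theorem closure_image_unitBall_absorbing
    {X : Type*} [Countable X]
    (F : X → Type*) [∀ x, NormedAddCommGroup (F x)] [∀ x, NormedSpace ℂ (F x)]
    [∀ x, FiniteDimensional ℂ (F x)]
    (A : (∀ x, F x) →L[ℂ] (∀ x, F x))
    (hinj : ∀ φ : ∀ x, F x →L[ℂ] ℂ, {x | φ x ≠ 0}.Finite →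
      (∀ f : ∀ x, F x, ∑ᶠ x, φ x (A f x) = 0) → ∀ x, φ x = 0) :
    ∀ K : Finset X, K.Nonempty →
      ∃ ε : ℝ, 0 < ε ∧ ∃ K' : Finset X, K'.Nonempty ∧
        {g : ∀ x, F x | ∑ x ∈ K', ‖g x‖ ≤ ε} ⊆
          closure (A '' {f : ∀ x, F x | ∑ x ∈ K, ‖f x‖ ≤ 1}) := by
  intro K hK
  obtain ⟨C, hC, K', hKK', hb⟩ := polar_bound F A (dual_inj F A hinj) K
  refine ⟨C⁻¹, inv_pos.2 hC, K', hK.mono hKK', ?_⟩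
  intro g hg
  by_contra hgc
  set U : Set (∀ x, F x) := {f | ∑ x ∈ K, ‖f x‖ ≤ 1} with hU
  have hUc : Convex ℝ U := by
    intro f hf f' hf' a b ha hb' hab
    simp only [hU, Set.mem_ofPred_eq] at hf hf' ⊢
    calc ∑ x ∈ K, ‖(a • f + b • f') x‖ ≤ ∑ x ∈ K, (a * ‖f x‖ + b * ‖f' x‖) := by
          refine Finset.sum_le_sum fun x _ => ?_
          refine (norm_add_le _ _).trans ?_
          simp [norm_smul, abs_of_nonneg ha, abs_of_nonneg hb']
      _ = a * ∑ x ∈ K, ‖f x‖ + b * ∑ x ∈ K, ‖f' x‖ := by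
          rw [Finset.sum_add_distrib, Finset.mul_sum, Finset.mul_sum]
      _ ≤ a * 1 + b * 1 := by gcongr
      _ = 1 := by linarith
  have hcc : Convex ℝ (closure (A '' U)) :=
    (hUc.linear_image (A.toLinearMap.restrictScalars ℝ)).closure
  obtain ⟨ψ, u, hlt, hgt⟩ :=
    RCLike.geometric_hahn_banach_closed_point (𝕜 := ℂ) hcc isClosed_closure hgc
  have hUlt : ∀ f ∈ U, (ψ (A f)).re < u := fun f hf => hlt _ (subset_closure ⟨f, hf, rfl⟩)
  have hu : 0 < u := by
    have := hUlt 0 (by simp [hU])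
    simpa using this
  have hUn : ∀ f ∈ U, ‖ψ (A f)‖ ≤ u := by
    intro f hf
    by_cases h0 : ψ (A f) = 0
    · simp [h0, hu.le]
    have hn : (‖ψ (A f)‖ : ℂ) ≠ 0 := by simpa using h0
    let c : ℂ := ‖ψ (A f)‖ / ψ (A f)
    have hc : ‖c‖ = 1 := by simp [c, h0]
    have := hUlt (c • f) (by simpa [hU, norm_smul, hc] using hf)
    have e : ψ (A (c • f)) = (‖ψ (A f)‖ : ℂ) := by
      simp [c, h0]
    rw [e, Complex.ofReal_re] at this
    exact this.le
  have hbd : ∀ f, ‖ψ (A f)‖ ≤ u * ∑ x ∈ K, ‖f x‖ := by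
    intro f
    rw [← div_le_iff₀' hu]
    refine le_of_forall_gt_imp_ge_of_dense fun r hr => ?_
    have hr0 : 0 < r := lt_of_le_of_lt (by positivity) hr
    have := hUn (((r⁻¹ : ℝ) : ℂ) • f) (by
      simp only [hU, Set.mem_ofPred_eq, Pi.smul_apply, norm_smul, ← Finset.mul_sum,
        Complex.norm_real, Real.norm_eq_abs, abs_of_pos (inv_pos.2 hr0)]
      rw [inv_mul_le_iff₀ hr0]
      linarith)
    rw [map_smul, map_smul, norm_smul, Complex.norm_real, Real.norm_eq_abs,
      abs_of_pos (inv_pos.2 hr0), inv_mul_le_iff₀ hr0] at this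
    rwa [div_le_iff₀ hu]
  have h1 := hb ψ u hbd hu.le g
  have h2 : C * u * ∑ x ∈ K', ‖g x‖ ≤ C * u * C⁻¹ := by
    gcongr
    exact hg
  have h3 : C * u * C⁻¹ = u := by field_simp
  have h4 : (ψ g).re ≤ ‖ψ g‖ := Complex.re_le_norm _
  have h5 : u < (ψ g).re := hgt
  linarith
end

section
/- Let (X,b) be a locally finite weighted graph all of whose connected components are infinite. Then the graph Laplacian L : C(X) → C(X), Lf(x) = ∑_{y∈X} b(x,y)(f(x)-f(y)), is surjective. -/
/-- Maximum principle for finitely supported harmonic functions. -/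
theorem aux_max {X : Type*} (b : X → X → ℝ)
    (hbnn : ∀ x y, 0 ≤ b x y)
    (hlf : ∀ x, {y | b x y ≠ 0}.Finite)
    (hinfcomp : ∀ x, {y | Relation.ReflTransGen (fun u v => 0 < b u v) x y}.Infinite)
    (g : X →₀ ℝ)
    (hg : ∀ x, ∑ y ∈ (hlf x).toFinset, b x y * (g x - g y) = 0) (x : X) : g x ≤ 0 := by
  by_contra! hx
  have hxs : x ∈ g.support := by simp [hx.ne']
  obtain ⟨m, hm, hmax⟩ := g.support.exists_max_image g ⟨x, hxs⟩
  have hm0 : 0 < g m := hx.trans_le (hmax x hxs)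
  have hall : ∀ y, g y ≤ g m := by
    intro y
    by_cases hy : y ∈ g.support
    · exact hmax y hy
    · rw [Finsupp.notMem_support_iff.1 hy]; exact hm0.le
  have key : ∀ y, Relation.ReflTransGen (fun u v => 0 < b u v) m y → g y = g m := by
    intro y hy
    induction hy with
    | refl => rfl
    | @tail u v _ huv ih =>
      have h := (Finset.sum_eq_zero_iff_of_nonneg (fun y _ =>
        mul_nonneg (hbnn u y) (by rw [ih]; linarith [hall y]))).1 (hg u) v
          (by simpa using huv.ne')
      rcases mul_eq_zero.1 h with h | h
      · exact absurd h huv.ne'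
      · linarith
  refine hinfcomp m (g.support.finite_toSet.subset ?_)
  intro y hy
  have := key y hy
  simp only [Finset.mem_coe, Finsupp.mem_support_iff]
  rw [this]; exact hm0.ne'

theorem aux_real {X : Type*} (b : X → X → ℝ)
    (hbnn : ∀ x y, 0 ≤ b x y)
    (hsym : ∀ x y, b x y = b y x)
    (hlf : ∀ x, {y | b x y ≠ 0}.Finite)
    (hinfcomp : ∀ x, {y | Relation.ReflTransGen (fun u v => 0 < b u v) x y}.Infinite)
    (h : X → ℝ) :
    ∃ f : X → ℝ, ∀ x, ∑ y ∈ (hlf x).toFinset, b x y * (f x - f y) = h x := by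
  classical
  let T : (X →₀ ℝ) →ₗ[ℝ] (X →₀ ℝ) := Finsupp.linearCombination ℝ (fun x =>
    ∑ y ∈ (hlf x).toFinset, b x y • (Finsupp.single x (1 : ℝ) - Finsupp.single y 1))
  have hT : ∀ g z, T g z = ∑ y ∈ (hlf z).toFinset, b z y * (g z - g y) := by
    intro g z
    induction g using Finsupp.induction_linear with
    | zero => simp
    | add g₁ g₂ h₁ h₂ =>
      rw [map_add, Finsupp.add_apply, h₁, h₂, ← Finset.sum_add_distrib]
      refine Finset.sum_congr rfl fun y _ => ?_
      simp only [Finsupp.add_apply]; ring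
    | single x c =>
      simp only [T, Finsupp.linearCombination_single, Finsupp.smul_apply, Finsupp.finsetSum_apply,
        Finsupp.sub_apply, smul_eq_mul]
      by_cases hxz : x = z
      · subst hxz
        rw [Finset.mul_sum]
        refine Finset.sum_congr rfl fun y _ => ?_
        by_cases hy : x = y
        · subst hy; simp
        · have hy' : y ≠ x := fun e => hy e.symm
          simp [Finsupp.single_apply, hy, hy']; ring
      · have hzx : z ≠ x := fun e => hxz e.symm
        simp only [Finsupp.single_apply, hxz, if_false, zero_sub, mul_neg, mul_ite, mul_one,
          mul_zero, Finset.sum_neg_distrib, Finset.sum_ite_eq, Finset.sum_ite_eq',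
          Set.Finite.mem_toFinset, Set.mem_setOf_eq, hsym z x]
        split_ifs <;> ring
  have hinj : Function.Injective T := by
    rw [injective_iff_map_eq_zero]
    intro g hg
    have h1 : ∀ x, ∑ y ∈ (hlf x).toFinset, b x y * (g x - g y) = 0 := by
      intro x; rw [← hT, hg]; rfl
    have h2 : ∀ x, ∑ y ∈ (hlf x).toFinset, b x y * ((-g) x - (-g) y) = 0 := by
      intro x; rw [← hT, map_neg, hg]; simp
    ext x
    have a1 := aux_max b hbnn hlf hinfcomp g h1 x
    have a2 := aux_max b hbnn hlf hinfcomp (-g) h2 x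
    simp only [Finsupp.neg_apply] at a2
    simp only [Finsupp.zero_apply]
    linarith
  obtain ⟨φ, hφ⟩ := LinearMap.dualMap_surjective_of_injective hinj
    (Finsupp.linearCombination ℝ h)
  refine ⟨fun x => φ (Finsupp.single x 1), fun x => ?_⟩
  have := LinearMap.congr_fun hφ (Finsupp.single x 1)
  simpa [T, LinearMap.dualMap_apply, map_sum] using this

/-- **Surjectivity of the graph Laplacian.**
Let `(X,b)` be a locally finite weighted graph all of whose connected components are
infinite.  Then the graph Laplacian `L f x = ∑_y b(x,y)(f x - f y)` is surjective
on `C(X)`, the space of all complex-valued functions on `X`. -/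
theorem graph_laplacian_surjective
    {X : Type*} [Countable X]
    (b : X → X → ℝ)
    (hb0 : ∀ x, b x x = 0)
    (hbnn : ∀ x y, 0 ≤ b x y)
    (hsym : ∀ x y, b x y = b y x)
    (hlf : ∀ x, {y | b x y ≠ 0}.Finite)
    (hinfcomp : ∀ x, {y | Relation.ReflTransGen (fun u v => 0 < b u v) x y}.Infinite) :
    Function.Surjective (fun (f : X → ℂ) (x : X) =>
      ∑ᶠ y, (b x y : ℂ) * (f x - f y)) := by
  intro h
  obtain ⟨u, hu⟩ := aux_real b hbnn hsym hlf hinfcomp (fun x => (h x).re)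
  obtain ⟨v, hv⟩ := aux_real b hbnn hsym hlf hinfcomp (fun x => (h x).im)
  refine ⟨fun x => ⟨u x, v x⟩, ?_⟩
  funext x
  simp only
  rw [finsum_eq_sum_of_support_subset (s := (hlf x).toFinset)]
  · apply Complex.ext
    · rw [← hu x, Complex.re_sum]
      simp
    · rw [← hv x, Complex.im_sum]
      simp
  · intro y hy
    simp only [Function.mem_support] at hy
    simp only [Set.Finite.coe_toFinset, Set.mem_setOf_eq]
    intro h0
    simp [h0] at hy
end
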